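/- Let a > 1 and N > 1/2, and let f(s) = s·e^{−s}. Then for every s > 0, Σ_{j ∈ ℤ, a^{2j} > N·a²/s} |f(a^{2j}·s)|² ≤ (a²/(a²−1))·e^{−2N}·(N/2 + 1/4). -/

import Mathlib

open Set

/-- A lower bound for the integral of `u e^{−2u}` over `[x, t]`, where `1/2 ≤ x ≤ t`, in terms of
the primitive `−(u/2 + 1/4) e^{−2u}`. -/
lemma sub_mul_mul_exp_le {x t : ℝ} (hx : 1 / 2 ≤ x) (hxt : x ≤ t) :
    (t - x) * (t * Real.exp (-2 * t)) ≤
      (x / 2 + 1 / 4) * Real.exp (-2 * x) - (t / 2 + 1 / 4) * Real.exp (-2 * t) := by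
  have hd : 0 ≤ t - x := sub_nonneg.2 hxt
  have hexp := Real.quadratic_le_exp_of_nonneg (mul_nonneg zero_le_two hd)
  have hsplit : Real.exp (-2 * x) = Real.exp (2 * (t - x)) * Real.exp (-2 * t) := by
    rw [← Real.exp_add]
    ring_nf
  have key : (t - x) * t + (t / 2 + 1 / 4) ≤ (x / 2 + 1 / 4) * Real.exp (2 * (t - x)) := by
    have h := mul_le_mul_of_nonneg_left hexp (by linarith : 0 ≤ x / 2 + 1 / 4)
    nlinarith [mul_nonneg (sub_nonneg.2 hx) (sq_nonneg (t - x))]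
  rw [hsplit]
  nlinarith [mul_le_mul_of_nonneg_right key (Real.exp_pos (-2 * t)).le]

/-- A geometric sum of `t² e^{−2t}` over finitely many points `t = q ^ j * s` beyond `N * q` is
bounded by a telescoping sum. -/
lemma sum_sq_mul_exp_le {q N s : ℝ} (hq : 1 < q) (hN : 1 / 2 ≤ N) (hs : 0 < s) (u : Finset ℤ) :
    (∀ j ∈ u, N * q ≤ q ^ j * s) → ∀ M : ℝ, N ≤ M → (∀ j ∈ u, q ^ j * s ≤ M) →
      ∑ j ∈ u, (q ^ j * s) ^ 2 * Real.exp (-2 * (q ^ j * s)) ≤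
        q / (q - 1) * ((N / 2 + 1 / 4) * Real.exp (-2 * N) -
          (M / 2 + 1 / 4) * Real.exp (-2 * M)) := by
  have hq0 : 0 < q := by linarith
  have hq1 : 0 < q - 1 := by linarith
  have anti : ∀ {x t : ℝ}, 1 / 2 ≤ x → x ≤ t →
      0 ≤ (x / 2 + 1 / 4) * Real.exp (-2 * x) - (t / 2 + 1 / 4) * Real.exp (-2 * t) :=
    fun {x t} hx hxt => le_trans (mul_nonneg (sub_nonneg.2 hxt)
      (mul_nonneg (by linarith) (Real.exp_pos _).le)) (sub_mul_mul_exp_le hx hxt)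
  induction u using Finset.induction_on_max with
  | empty =>
    intro _ M hM _
    simpa using mul_nonneg (div_pos hq0 hq1).le (anti hN hM)
  | insert k u hk ih =>
    intro hu M hM hle
    have hshift : q ^ k * s = q * (q ^ (k - 1) * s) := by
      rw [zpow_sub_one₀ hq0.ne']
      field_simp
    have hNx : N ≤ q ^ (k - 1) * s := by
      have h := hu k (Finset.mem_insert_self _ _)
      rw [hshift] at h
      nlinarith
    have hsum := ih (fun j hj => hu j (Finset.mem_insert_of_mem hj)) _ hNx fun j hj =>
      mul_le_mul_of_nonneg_right
        (zpow_le_zpow_right₀ hq.le (Int.le_sub_one_of_lt (hk j hj))) hs.le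
    have hkM := hle k (Finset.mem_insert_self _ _)
    rw [Finset.sum_insert fun h => lt_irrefl k (hk k h)]
    set x := q ^ (k - 1) * s
    set t := q ^ k * s
    have hxt : x ≤ t := by nlinarith
    have hterm := mul_le_mul_of_nonneg_left
      (sub_mul_mul_exp_le (hN.trans hNx) hxt) (div_pos hq0 hq1).le
    have heq : q / (q - 1) * ((t - x) * (t * Real.exp (-2 * t))) = t ^ 2 * Real.exp (-2 * t) := by
      have : q / (q - 1) * (t - x) = t := by
        rw [hshift]
        field_simp
      linear_combination (t * Real.exp (-2 * t)) * this
    have hlast := mul_nonneg (div_pos hq0 hq1).le (anti ((hN.trans hNx).trans hxt) hkM)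
    rw [heq] at hterm
    linarith

/-- For `f(s) = s e^{−s}`, `a > 1` and `N > 1/2`, for every `s > 0`,
`Σ_{j : a^{2j} > N a²/s} |f(a^{2j} s)|² ≤ (a²/(a²−1)) e^{−2N} (N/2 + 1/4)`. -/
theorem stmt18 (a N : ℝ) (ha : 1 < a) (hN : 1 / 2 < N)
    (f : ℝ → ℝ) (hf : ∀ s : ℝ, f s = s * Real.exp (-s)) :
    ∀ s : ℝ, 0 < s →
      Summable (fun j : {j : ℤ // N * a ^ 2 / s < a ^ (2 * j)} =>
        f (a ^ (2 * (j : ℤ)) * s) ^ 2) ∧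
      (∑' j : {j : ℤ // N * a ^ 2 / s < a ^ (2 * j)}, f (a ^ (2 * (j : ℤ)) * s) ^ 2) ≤
        a ^ 2 / (a ^ 2 - 1) * Real.exp (-2 * N) * (N / 2 + 1 / 4) := by
  intro s hs
  have hq : 1 < a ^ 2 := one_lt_pow₀ ha two_ne_zero
  have hf' : ∀ j : ℤ, f (a ^ (2 * j) * s) ^ 2 =
      ((a ^ 2) ^ j * s) ^ 2 * Real.exp (-2 * ((a ^ 2) ^ j * s)) := fun j => by
    rw [hf, mul_pow, ← Real.exp_nat_mul, zpow_mul, zpow_ofNat]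
    push_cast
    ring_nf
  have hbound : ∀ u : Finset {j : ℤ // N * a ^ 2 / s < a ^ (2 * j)},
      ∑ j ∈ u, f (a ^ (2 * (j : ℤ)) * s) ^ 2 ≤
        a ^ 2 / (a ^ 2 - 1) * Real.exp (-2 * N) * (N / 2 + 1 / 4) := fun u => by
    obtain ⟨B, hB⟩ := ((u.map (Function.Embedding.subtype _)).image
      fun j : ℤ => (a ^ 2) ^ j * s).bddAbove
    have h := sum_sq_mul_exp_le hq hN.le hs (u.map (Function.Embedding.subtype _))
      (fun j hj => by
        obtain ⟨i, -, rfl⟩ := Finset.mem_map.1 hj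
        have hi := (div_lt_iff₀ hs).1 i.2
        rw [zpow_mul, zpow_ofNat] at hi
        exact hi.le)
      (max N B) (le_max_left _ _)
      (fun j hj => (hB (Finset.mem_coe.2 (Finset.mem_image_of_mem _ hj))).trans (le_max_right _ _))
    rw [Finset.sum_map] at h
    simp only [hf']
    refine h.trans ?_
    rw [mul_assoc, mul_comm (Real.exp _)]
    have hM : 0 ≤ max N B := le_max_of_le_left (by linarith)
    have : 0 ≤ a ^ 2 - 1 := by linarith
    gcongr
    exact sub_le_self _ (by positivity)
  have hsum := summable_of_sum_le (fun j => sq_nonneg _) hbound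
  exact ⟨hsum, hsum.tsum_le_of_sum_le hbound⟩
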